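/- Let q be a prime power, m ≥ 2 an integer, and n = (q^m − 1)/(q − 1). Let C be any linear code over GF(q) of length n, dimension n − m, and minimum distance 3 (any such code is a q-ary Hamming code, as all [n, n − m, 3] codes over GF(q) are monomially equivalent). Then C has minimum linear locality q^{m−1} − 1, and the dual code C⊥ (the q-ary Simplex code, of dimension m) has minimum linear locality 2. -/

import Mathlib

open scoped BigOperators

variable {F : Type*} [Field F] {ι : Type*} [Fintype ι]

/-- The Hamming weight of a word: the number of nonzero coordinates. -/
noncomputable def wt (c : ι → F) : ℕ := {i | c i ≠ 0}.ncard

/-- The minimum distance of a linear code: the least Hamming weight of a nonzero codeword. -/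
noncomputable def minDist (C : Submodule F (ι → F)) : ℕ :=
  sInf {w | ∃ c ∈ C, c ≠ 0 ∧ wt c = w}

/-- The dual code of a linear code. -/
def dualCode (C : Submodule F (ι → F)) : Submodule F (ι → F) where
  carrier := {x | ∀ c ∈ C, ∑ i, x i * c i = 0}
  add_mem' := by
    intro a b ha hb c hc
    have h1 := ha c hc
    have h2 := hb c hc
    simp only [Set.mem_setOf_eq, Pi.add_apply, add_mul, Finset.sum_add_distrib, h1, h2, add_zero]
  zero_mem' := by intro c hc; simp
  smul_mem' := by
    intro r a ha c hc
    have h := ha c hc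
    simp only [Set.mem_setOf_eq, Pi.smul_apply, smul_eq_mul, mul_assoc, ← Finset.mul_sum, h,
      mul_zero]

/-- `C` has linear locality `r`: every code symbol `c i` is a fixed linear combination of
at most `r` other code symbols. -/
def HasLinearLocality (C : Submodule F (ι → F)) (r : ℕ) : Prop :=
  ∀ i : ι, ∃ (R : Finset ι) (u : ι → F), i ∉ R ∧ R.card ≤ r ∧
    ∀ c ∈ C, c i = ∑ j ∈ R, u j * c j

theorem wt_le_card {c : ι → F} (s : Finset ι) (h : ∀ i, c i ≠ 0 → i ∈ s) : wt c ≤ s.card := by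
  rw [wt, ← Set.ncard_coe_finset]
  exact Set.ncard_le_ncard h

theorem wt_eq_card [DecidableEq F] (c : ι → F) : wt c = (Finset.univ.filter (c · ≠ 0)).card := by
  rw [wt, ← Set.ncard_coe_finset]
  simp

theorem hasLinearLocality_iff (C : Submodule F (ι → F)) (r : ℕ) :
    HasLinearLocality C r ↔ ∀ i, ∃ x ∈ dualCode C, x i ≠ 0 ∧ wt x ≤ r + 1 := by
  classical
  refine forall_congr' fun i => ⟨?_, ?_⟩
  · rintro ⟨R, u, hi, hR, h⟩
    refine ⟨fun j => if j = i then 1 else if j ∈ R then -u j else 0, fun c hc => ?_, by simp, ?_⟩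
    · rw [← Finset.add_sum_erase _ _ (Finset.mem_univ i)]
      have : ∑ j ∈ Finset.univ.erase i, (if j = i then 1 else if j ∈ R then -u j else 0) * c j =
          ∑ j ∈ R, -(u j * c j) := by
        symm
        refine Finset.sum_subset_zero_on_sdiff (fun j hj => ?_) (fun j hj => ?_) (fun j hj => ?_)
        · simp only [Finset.mem_erase, Finset.mem_univ, and_true]
          rintro rfl
          exact hi hj
        · simp_all
        · have : j ≠ i := by
            rintro rfl
            exact hi hj
          simp [this, hj]
      rw [this, Finset.sum_neg_distrib, ← h c hc]
      simp
    · refine (wt_le_card (insert i R) fun j hj => ?_).trans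
        ((Finset.card_insert_le _ _).trans (by omega))
      by_contra hj'
      simp_all
  · rintro ⟨x, hx, hxi, hw⟩
    rw [wt_eq_card] at hw
    refine ⟨(Finset.univ.filter (x · ≠ 0)).erase i, fun j => -(x i)⁻¹ * x j, by simp, ?_,
      fun c hc => ?_⟩
    · rw [Finset.card_erase_of_mem (by simpa using hxi)]
      omega
    · have h := hx c hc
      rw [← Finset.add_sum_erase _ _ (Finset.mem_univ i)] at h
      have hsum : ∑ j ∈ (Finset.univ.filter (x · ≠ 0)).erase i, x j * c j =
          ∑ j ∈ Finset.univ.erase i, x j * c j := by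
        refine Finset.sum_subset (Finset.erase_subset_erase _ (Finset.subset_univ _)) fun j _ hj => ?_
        by_cases hj0 : x j = 0 <;> simp_all
      simp_rw [mul_assoc]
      rw [← Finset.mul_sum, hsum, eq_neg_of_add_eq_zero_right h]
      field_simp

variable (F ι) in
/-- The standard dot product on words, as a bilinear form. -/
def dotForm : LinearMap.BilinForm F (ι → F) := dotProductBilin F F

theorem dotForm_apply (x y : ι → F) : dotForm F ι x y = ∑ i, x i * y i := rfl

theorem dualCode_eq_orthogonal (C : Submodule F (ι → F)) :
    dualCode C = (dotForm F ι).orthogonal C := by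
  ext x
  rw [LinearMap.BilinForm.mem_orthogonal_iff]
  refine forall₂_congr fun c _ => ?_
  simp_rw [dotForm_apply, mul_comm]

theorem isRefl_dotForm : (dotForm F ι).IsRefl := fun x y h => by
  rw [dotForm_apply] at h ⊢
  simpa only [mul_comm] using h

theorem nondegenerate_dotForm : (dotForm F ι).Nondegenerate := by
  classical
  refine ⟨fun x hx => funext fun i => ?_, fun x hx => funext fun i => ?_⟩ <;>
  simpa [dotForm_apply, Pi.single_apply] using hx (Pi.single i 1)

theorem dualCode_dualCode (C : Submodule F (ι → F)) : dualCode (dualCode C) = C := by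
  simp_rw [dualCode_eq_orthogonal]
  exact LinearMap.BilinForm.orthogonal_orthogonal nondegenerate_dotForm isRefl_dotForm C

theorem finrank_dualCode (C : Submodule F (ι → F)) :
    Module.finrank F (dualCode C) = Fintype.card ι - Module.finrank F C := by
  rw [dualCode_eq_orthogonal, LinearMap.BilinForm.finrank_orthogonal nondegenerate_dotForm,
    Module.finrank_fintype_fun_eq_card]

theorem minDist_le_wt {C : Submodule F (ι → F)} {c : ι → F} (hc : c ∈ C) (h0 : c ≠ 0) :
    minDist C ≤ wt c :=
  Nat.sInf_le ⟨c, hc, h0, rfl⟩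

theorem eq_zero_of_support_subset {C : Submodule F (ι → F)} (s : Finset ι) {c : ι → F}
    (hs : s.card < minDist C) (hc : c ∈ C) (h : ∀ i, c i ≠ 0 → i ∈ s) : c = 0 := by
  by_contra h0
  exact absurd ((minDist_le_wt hc h0).trans (wt_le_card s h)) hs.not_ge

section Syndrome

variable [DecidableEq ι] (C : Submodule F (ι → F))

/-- The class of the `i`-th unit word modulo the code: a column of a parity-check matrix,
as a point of the syndrome space. -/
def unitSyndrome (i : ι) : (ι → F) ⧸ C := C.mkQ (Pi.single i 1)

theorem smul_unitSyndrome (a : F) (i : ι) : a • unitSyndrome C i = C.mkQ (Pi.single i a) := by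
  rw [unitSyndrome, ← map_smul, ← Pi.single_smul, smul_eq_mul, mul_one]

variable {C}

theorem injective_smul_unitSyndrome (hd : 3 ≤ minDist C) :
    Function.Injective fun p : Fˣ × ι => (p.1 : F) • unitSyndrome C p.2 := by
  rintro ⟨a, i⟩ ⟨b, j⟩ h
  simp only [smul_unitSyndrome] at h
  rw [← sub_eq_zero, ← map_sub, Submodule.mkQ_apply, Submodule.Quotient.mk_eq_zero] at h
  have h0 : (Pi.single i (a : F) - Pi.single j (b : F) : ι → F) = 0 := by
    refine eq_zero_of_support_subset {i, j} (Finset.card_le_two.trans_lt hd) h fun k hk => ?_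
    by_contra hk'
    simp_all
  have hij : i = j := by
    by_contra hij
    simpa [hij] using congrFun h0 i
  subst hij
  have hab := congrFun h0 i
  simp only [Pi.sub_apply, Pi.single_eq_same, Pi.zero_apply, sub_eq_zero] at hab
  rw [Units.ext hab]

variable [Fintype F]

theorem range_smul_unitSyndrome (hd : 3 ≤ minDist C)
    (hcard : Fintype.card ι * (Fintype.card F - 1) + 1 = Nat.card ((ι → F) ⧸ C)) :
    Set.range (fun p : Fˣ × ι => (p.1 : F) • unitSyndrome C p.2) = {0}ᶜ := by
  classical
  refine Set.eq_of_subset_of_ncard_le ?_ ?_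
  · rintro _ ⟨⟨a, i⟩, rfl⟩ h
    simp only [smul_unitSyndrome, Set.mem_singleton_iff] at h
    rw [Submodule.mkQ_apply, Submodule.Quotient.mk_eq_zero] at h
    have h0 := eq_zero_of_support_subset {i} (by simp; omega) h fun k hk => by
      by_contra hk'
      simp_all
    simpa using congrFun h0 i
  · rw [Set.ncard_compl, Set.ncard_singleton, ← hcard,
      Set.ncard_range_of_injective (injective_smul_unitSyndrome hd), Nat.card_prod,
      Nat.card_eq_fintype_card, Nat.card_eq_fintype_card, Fintype.card_units, mul_comm]
    omega

theorem wt_of_mem_dualCode {m : ℕ} (hd : 3 ≤ minDist C)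
    (hrank : Module.finrank F ((ι → F) ⧸ C) = m)
    (hcard : Fintype.card ι * (Fintype.card F - 1) + 1 = Fintype.card F ^ m)
    {x : ι → F} (hx : x ∈ dualCode C) (h0 : x ≠ 0) : wt x = Fintype.card F ^ (m - 1) := by
  classical
  have hV : Nat.card ((ι → F) ⧸ C) = Fintype.card F ^ m := by
    rw [Module.natCard_eq_pow_finrank (K := F), hrank, Nat.card_eq_fintype_card]
  let f : Module.Dual F ((ι → F) ⧸ C) := C.liftQ (dotForm F ι x) hx
  have hf (a : F) (i : ι) : f (a • unitSyndrome C i) = x i * a := by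
    rw [smul_unitSyndrome]
    change dotForm F ι x _ = _
    simp [dotForm_apply, Pi.single_apply]
  have hf1 (i : ι) : f (unitSyndrome C i) = x i := by simpa using hf 1 i
  have hf0 : f ≠ 0 := by
    rintro h
    refine h0 (funext fun i => ?_)
    simpa [h] using (hf1 i).symm
  have hker := Module.Dual.finrank_ker_add_one_of_ne_zero hf0
  have himage : (fun p : Fˣ × ι => (p.1 : F) • unitSyndrome C p.2) ''
      (Set.univ ×ˢ {i | x i ≠ 0}) = (LinearMap.ker f : Set ((ι → F) ⧸ C))ᶜ := by
    ext v
    constructor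
    · rintro ⟨⟨a, i⟩, ⟨-, hi⟩, rfl⟩
      simpa [hf1] using hi
    · intro hv
      have hv0 : v ∈ ({0}ᶜ : Set ((ι → F) ⧸ C)) := by
        rintro rfl
        simp at hv
      rw [← range_smul_unitSyndrome hd (hcard.trans hV.symm)] at hv0
      obtain ⟨⟨a, i⟩, rfl⟩ := hv0
      refine ⟨(a, i), ⟨trivial, ?_⟩, rfl⟩
      simpa [hf1] using hv
  have hcount := congrArg Set.ncard himage
  rw [Set.ncard_image_of_injective _ (injective_smul_unitSyndrome hd), Set.ncard_prod,
    Set.ncard_univ, Nat.card_eq_fintype_card, Fintype.card_units, Set.ncard_compl, hV] at hcount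
  change _ * wt x = _ - Nat.card (LinearMap.ker f) at hcount
  obtain ⟨k, rfl⟩ : ∃ k, m = k + 1 := ⟨_, (hker.trans hrank).symm⟩
  have hk : Module.finrank F (LinearMap.ker f) = k := by omega
  rw [Module.natCard_eq_pow_finrank (K := F), Nat.card_eq_fintype_card, hk, pow_succ',
    ← Nat.sub_one_mul] at hcount
  exact Nat.eq_of_mul_eq_mul_left (Nat.sub_pos_of_lt Fintype.one_lt_card) hcount

theorem exists_mem_wt_le_three [Nontrivial ι] (hd : 3 ≤ minDist C)
    (hcard : Fintype.card ι * (Fintype.card F - 1) + 1 = Nat.card ((ι → F) ⧸ C)) (i : ι) :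
    ∃ c ∈ C, c i ≠ 0 ∧ wt c ≤ 3 := by
  obtain ⟨j, hj⟩ := exists_ne i
  have hpair (b : F) : (Pi.single i b + Pi.single j 1 : ι → F) ∉ C := by
    intro h
    have h0 := eq_zero_of_support_subset {i, j} (Finset.card_le_two.trans_lt hd) h fun k hk => by
      by_contra hk'
      simp_all
    simpa [hj] using congrFun h0 j
  have hne : C.mkQ (Pi.single i 1 + Pi.single j 1) ∈ ({0}ᶜ : Set ((ι → F) ⧸ C)) := by
    rw [Set.mem_compl_singleton_iff, Submodule.mkQ_apply, ne_eq, Submodule.Quotient.mk_eq_zero]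
    exact hpair 1
  rw [← range_smul_unitSyndrome hd hcard] at hne
  obtain ⟨⟨a, k⟩, h⟩ := hne
  beta_reduce at h
  rw [smul_unitSyndrome, eq_comm, ← sub_eq_zero, ← map_sub, Submodule.mkQ_apply,
    Submodule.Quotient.mk_eq_zero] at h
  refine ⟨_, h, ?_, (wt_le_card {i, j, k} fun l hl => ?_).trans Finset.card_le_three⟩
  · have hk : k ≠ i := by
      rintro rfl
      refine hpair (1 - a) ?_
      rwa [Pi.single_sub, sub_add_eq_add_sub]
    simp [hj.symm, hk.symm]
  · by_contra hl'
    simp_all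

end Syndrome

/-- Any `[n, n-m, 3]` code over `GF(q)` with `n = (q^m - 1)/(q - 1)`
(a `q`-ary Hamming code) has minimum linear locality `q^(m-1) - 1`, and its dual
(the `q`-ary Simplex code, of dimension `m`) has minimum linear locality `2`. -/
theorem statement8 {F : Type*} [Field F] [Fintype F] (q m n : ℕ)
    (hq : Fintype.card F = q) (hm : 2 ≤ m) (hn : n * (q - 1) = q ^ m - 1)
    (C : Submodule F (Fin n → F))
    (hdim : Module.finrank F C = n - m) (hd : minDist C = 3) :
    IsLeast {r : ℕ | HasLinearLocality C r} (q ^ (m - 1) - 1) ∧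
    Module.finrank F (dualCode C) = m ∧
    IsLeast {r : ℕ | HasLinearLocality (dualCode C) r} 2 := by
  subst hq
  have hq1 : 1 < Fintype.card F := Fintype.one_lt_card
  have hmn : m ≤ n := by
    refine Nat.le_of_mul_le_mul_right (c := Fintype.card F - 1) ?_ (by omega)
    have hb := one_add_mul_le_pow (a := ((Fintype.card F - 1 : ℕ) : ℤ)) (by omega) m
    have hcast : ((Fintype.card F - 1 : ℕ) : ℤ) + 1 = (Fintype.card F : ℤ) := by omega
    rw [add_comm 1 ((Fintype.card F - 1 : ℕ) : ℤ), hcast] at hb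
    have hb' : 1 + m * (Fintype.card F - 1) ≤ Fintype.card F ^ m := by exact_mod_cast hb
    omega
  have hpow : 0 < Fintype.card F ^ m := by positivity
  have hcard : Fintype.card (Fin n) * (Fintype.card F - 1) + 1 = Fintype.card F ^ m := by
    rw [Fintype.card_fin]
    omega
  have hrank : Module.finrank F ((Fin n → F) ⧸ C) = m := by
    have := C.finrank_quotient_add_finrank
    rw [Module.finrank_fin_fun] at this
    omega
  have hV : Nat.card ((Fin n → F) ⧸ C) = Fintype.card F ^ m := by
    rw [Module.natCard_eq_pow_finrank (K := F), hrank, Nat.card_eq_fintype_card]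
  have : Nontrivial (Fin n) := Fin.nontrivial_iff_two_le.2 (hm.trans hmn)
  obtain ⟨i₀⟩ : Nonempty (Fin n) := inferInstance
  refine ⟨⟨?_, fun r hr => ?_⟩, ?_, ?_, fun r hr => ?_⟩
  · refine (hasLinearLocality_iff _ _).2 fun i => ?_
    obtain ⟨x, hx, hxi⟩ : ∃ x ∈ dualCode C, x i ≠ 0 := by
      by_contra! h
      have hi : Pi.single i 1 ∈ dualCode (dualCode C) := fun x hx => by
        simp [Pi.single_apply, h x hx]
      rw [dualCode_dualCode] at hi
      have h0 := eq_zero_of_support_subset {i} (by simp [hd]) hi fun k hk => by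
        by_contra hk'
        simp_all
      simpa using congrFun h0 i
    refine ⟨x, hx, hxi, ?_⟩
    rw [wt_of_mem_dualCode hd.ge hrank hcard hx (ne_of_apply_ne (· i) hxi)]
    omega
  · obtain ⟨x, hx, hxi, hw⟩ := (hasLinearLocality_iff _ _).1 hr i₀
    rw [wt_of_mem_dualCode hd.ge hrank hcard hx (ne_of_apply_ne (· i₀) hxi)] at hw
    omega
  · rw [finrank_dualCode, hdim, Fintype.card_fin]
    omega
  · refine (hasLinearLocality_iff _ _).2 fun i => ?_
    rw [dualCode_dualCode]
    exact exists_mem_wt_le_three hd.ge (hcard.trans hV.symm) i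
  · obtain ⟨x, hx, hxi, hw⟩ := (hasLinearLocality_iff _ _).1 hr i₀
    rw [dualCode_dualCode] at hx
    have := minDist_le_wt hx (ne_of_apply_ne (· i₀) hxi)
    omega
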